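/- arXiv:1110.4860 — 2 statements merged into one kernel-verified Lean document; each statement's English description precedes it below -/
import Mathlib

section
/- Let M be a matroid on a finite ground set X with independent-set family ℐ, let f : 2^X → ℝ≥0 be a nonnegative submodular function with multilinear extension F, let t ∈ [0,1], and let P_t(M) = conv{1_I : I ∈ ℐ} ∩ [0,t]^X. Suppose x ∈ P_t(M) is a fractional local optimum in the following sense (all partial derivatives evaluated at x): for every i such that x − ε e_i ∈ P_t(M) for some ε > 0, ∂F/∂x_i ≥ 0; for every j such that x + ε e_j ∈ P_t(M) for some ε > 0, ∂F/∂x_j ≤ 0; and for every i, j such that x + ε(e_j − e_i) ∈ P_t(M) for some ε > 0, ∂F/∂x_j ≤ ∂F/∂x_i. Then for every independent set C ∈ ℐ, writing C′ = {i ∈ C : x_i < t}, one has 2 F(x) ≥ F(x ∨ 1_{C′}) + F(x ∧ 1_C), where ∨ and ∧ denote coordinatewise maximum and minimum and 1_S is the indicator vector of S. -/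
/-- The multilinear extension `F(x) = ∑_{S⊆X} f(S) ∏_{i∈S} x_i ∏_{j∉S} (1 - x_j)`. -/
noncomputable def mExt {X : Type*} [Fintype X] [DecidableEq X]
    (f : Set X → ℝ) (x : X → ℝ) : ℝ :=
  ∑ S : Finset X, f ↑S * ((∏ i ∈ S, x i) * ∏ j ∈ Sᶜ, (1 - x j))

/-- The box-constrained matroid polytope
`P_t(M) = conv{1_I : I independent in M} ∩ [0,t]^X`. -/
noncomputable def indepPolytopeT {X : Type*} [Fintype X] (M : Matroid X) (t : ℝ) :
    Set (X → ℝ) :=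
  (convexHull ℝ) {v : X → ℝ | ∃ I : Set X, M.Indep I ∧ v = Set.indicator I 1}
    ∩ {y : X → ℝ | ∀ i, y i ∈ Set.Icc 0 t}

open Finset in
/-- Conditioning the multilinear extension on the coordinate `i`. -/
lemma mExt_eq_sum_erase {X : Type*} [Fintype X] [DecidableEq X] (f : Set X → ℝ) (i : X)
    (x : X → ℝ) :
    mExt f x = ∑ S ∈ (univ.erase i).powerset,
      ((∏ j ∈ S, x j) * ∏ j ∈ (univ.erase i) \ S, (1 - x j)) *
        (x i * f (insert i (S : Set X)) + (1 - x i) * f S) := by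
  have hu : (univ : Finset (Finset X)) = (insert i (univ.erase i)).powerset := by
    rw [insert_erase (mem_univ i), powerset_univ]
  rw [mExt, hu, sum_powerset_insert (notMem_erase i univ), ← sum_add_distrib]
  refine sum_congr rfl fun S hS => ?_
  have hiS : i ∉ S := fun h => notMem_erase i univ (mem_powerset.mp hS h)
  have h1 : Sᶜ = insert i ((univ.erase i) \ S) := by
    ext j; by_cases hj : j = i <;> simp [hj, hiS]
  have h2 : (insert i S)ᶜ = (univ.erase i) \ S := by
    ext j; simp
  rw [h2, h1, prod_insert hiS, prod_insert (by simp), coe_insert]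
  ring

open Finset in
/-- The slope of the multilinear extension of `f` in the coordinate `i`. -/
noncomputable def mExtSlope {X : Type*} [Fintype X] [DecidableEq X] (f : Set X → ℝ) (i : X)
    (x : X → ℝ) : ℝ :=
  ∑ S ∈ (univ.erase i).powerset,
    ((∏ j ∈ S, x j) * ∏ j ∈ (univ.erase i) \ S, (1 - x j)) * (f (insert i (S : Set X)) - f S)

open Finset in
lemma mExt_update {X : Type*} [Fintype X] [DecidableEq X] (f : Set X → ℝ) (i : X)
    (x : X → ℝ) (a : ℝ) :
    mExt f (Function.update x i a) = mExt f x + (a - x i) * mExtSlope f i x := by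
  rw [mExt_eq_sum_erase f i, mExt_eq_sum_erase f i x, mExtSlope, mul_sum, ← sum_add_distrib]
  refine sum_congr rfl fun S hS => ?_
  have hiS : i ∉ S := fun h => notMem_erase i univ (mem_powerset.mp hS h)
  have h1 : ∏ j ∈ S, Function.update x i a j = ∏ j ∈ S, x j :=
    prod_congr rfl fun j hj => Function.update_of_ne (ne_of_mem_of_not_mem hj hiS) _ _
  have h2 : ∏ j ∈ (univ.erase i) \ S, (1 - Function.update x i a j)
      = ∏ j ∈ (univ.erase i) \ S, (1 - x j) :=
    prod_congr rfl fun j hj => by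
      rw [Function.update_of_ne (by simp at hj; exact hj.1)]
  rw [h1, h2, Function.update_self]
  ring

open Finset in
lemma mExtSlope_eq_mExt {X : Type*} [Fintype X] [DecidableEq X] (f : Set X → ℝ) (i : X)
    (x : X → ℝ) :
    mExtSlope f i x = mExt (fun S => f (insert i S) - f (S \ {i})) x := by
  rw [mExt_eq_sum_erase _ i, mExtSlope]
  refine sum_congr rfl fun S hS => ?_
  have hiS : i ∉ S := fun h => notMem_erase i univ (mem_powerset.mp hS h)
  simp only [Set.insert_idem, Set.insert_sdiff_of_mem _ (Set.mem_singleton i)]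
  rw [Set.sdiff_singleton_eq_self (s := (S : Set X)) (by simpa using hiS)]
  ring

lemma fderiv_mExt_single {X : Type*} [Fintype X] [DecidableEq X] (f : Set X → ℝ) (i : X)
    (x : X → ℝ) :
    fderiv ℝ (mExt f) x (Pi.single i 1) = mExtSlope f i x := by
  have hd : DifferentiableAt ℝ (mExt f) x := by
    unfold mExt
    fun_prop
  rw [← hd.lineDeriv_eq_fderiv, lineDeriv]
  have : (fun s : ℝ => mExt f (x + s • (Pi.single i 1 : X → ℝ)))
      = fun s => mExt f x + s * mExtSlope f i x := by
    funext s
    have : x + s • (Pi.single i 1 : X → ℝ) = Function.update x i (x i + s) := by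
      ext j
      by_cases hj : j = i
      · subst hj; simp
      · simp [hj]
    rw [this, mExt_update]
    ring
  rw [this]
  simp

open Finset in
lemma mExtSlope_nonpos {X : Type*} [Fintype X] [DecidableEq X] {g : Set X → ℝ}
    (hg : Antitone g) (i : X) {x : X → ℝ} (hx : ∀ j, x j ∈ Set.Icc (0 : ℝ) 1) :
    mExtSlope g i x ≤ 0 :=
  sum_nonpos fun _ _ => mul_nonpos_of_nonneg_of_nonpos
    (mul_nonneg (prod_nonneg fun j _ => (hx j).1)
      (prod_nonneg fun j _ => sub_nonneg.2 (hx j).2))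
    (sub_nonpos.2 (hg (Set.subset_insert _ _)))

lemma mExt_antitone {X : Type*} [Fintype X] [DecidableEq X] {g : Set X → ℝ}
    (hg : Antitone g) {x y : X → ℝ} (hx : ∀ j, x j ∈ Set.Icc (0 : ℝ) 1)
    (hy : ∀ j, y j ∈ Set.Icc (0 : ℝ) 1) (hxy : x ≤ y) : mExt g y ≤ mExt g x := by
  suffices h : ∀ A : Finset X, mExt g (A.piecewise y x) ≤ mExt g x by
    simpa using h Finset.univ
  intro A
  induction A using Finset.induction_on with
  | empty => simp
  | insert i A hi ih =>
    rw [Finset.piecewise_insert, mExt_update, Finset.piecewise_eq_of_notMem _ _ _ hi]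
    have h1 : mExtSlope g i (A.piecewise y x) ≤ 0 := mExtSlope_nonpos hg i fun j => by
      by_cases hj : j ∈ A <;> simp only [hj, Finset.piecewise, if_true, if_false, hx, hy]
    nlinarith [hxy i]

lemma mExtSlope_antitone {X : Type*} [Fintype X] [DecidableEq X] {f : Set X → ℝ}
    (hsub : ∀ S T : Set X, f (S ∪ T) + f (S ∩ T) ≤ f S + f T) (i : X)
    {x y : X → ℝ} (hx : ∀ j, x j ∈ Set.Icc (0 : ℝ) 1)
    (hy : ∀ j, y j ∈ Set.Icc (0 : ℝ) 1) (hxy : x ≤ y) :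
    mExtSlope f i y ≤ mExtSlope f i x := by
  rw [mExtSlope_eq_mExt, mExtSlope_eq_mExt]
  refine mExt_antitone (fun S T hST => ?_) hx hy hxy
  have h := hsub (T \ {i}) (insert i S)
  have h1 : T \ {i} ∪ insert i S = insert i T := by
    ext j
    have := @hST j
    simp only [Set.mem_union, Set.mem_sdiff, Set.mem_singleton_iff, Set.mem_insert_iff]
    tauto
  have h2 : T \ {i} ∩ insert i S = S \ {i} := by
    ext j
    have := @hST j
    simp only [Set.mem_inter_iff, Set.mem_sdiff, Set.mem_singleton_iff, Set.mem_insert_iff]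
    tauto
  rw [h1, h2] at h
  linarith

/-- First-order bound expressing concavity of the multilinear extension of a submodular function
along nonnegative and nonpositive directions. -/
lemma mExt_le_add_sum {X : Type*} [Fintype X] [DecidableEq X] {f : Set X → ℝ}
    (hsub : ∀ S T : Set X, f (S ∪ T) + f (S ∩ T) ≤ f S + f T)
    {x y : X → ℝ} (hx : ∀ j, x j ∈ Set.Icc (0 : ℝ) 1)
    (hy : ∀ j, y j ∈ Set.Icc (0 : ℝ) 1) (hxy : x ≤ y ∨ y ≤ x) :
    mExt f y ≤ mExt f x + ∑ i, (y i - x i) * mExtSlope f i x := by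
  suffices h : ∀ A : Finset X,
      mExt f (A.piecewise y x) ≤ mExt f x + ∑ i ∈ A, (y i - x i) * mExtSlope f i x by
    simpa using h Finset.univ
  intro A
  induction A using Finset.induction_on with
  | empty => simp
  | insert i A hi ih =>
    rw [Finset.piecewise_insert, mExt_update, Finset.piecewise_eq_of_notMem _ _ _ hi,
      Finset.sum_insert hi]
    have hz : ∀ j, A.piecewise y x j ∈ Set.Icc (0 : ℝ) 1 := fun j => by
      by_cases hj : j ∈ A <;> simp only [hj, Finset.piecewise, if_true, if_false, hx, hy]
    have h1 : (y i - x i) * mExtSlope f i (A.piecewise y x)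
        ≤ (y i - x i) * mExtSlope f i x := by
      rcases hxy with h | h
      · exact mul_le_mul_of_nonneg_left
          (mExtSlope_antitone hsub i hx hz (A.le_piecewise_of_le_of_le h le_rfl))
          (sub_nonneg.2 (h i))
      · exact mul_le_mul_of_nonpos_left
          (mExtSlope_antitone hsub i hz hx (A.piecewise_le_of_le_of_le h le_rfl))
          (sub_nonpos.2 (h i))
    linarith

open Finset in
/-- If no removal, addition or exchange towards `D` increases the weight of the independent set
`I`, then `I \ D` is at least as heavy as `D \ I`. -/
lemma Matroid.Indep.sum_sdiff_le_sum_sdiff {X : Type*} [DecidableEq X] {M : Matroid X}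
    {I D : Finset X} (hI : M.Indep I) (hD : M.Indep D) (w : X → ℝ)
    (h_remove : ∀ i ∈ I \ D, 0 ≤ w i)
    (h_add : ∀ j ∈ D \ I, M.Indep (insert j (I : Set X)) → w j ≤ 0)
    (h_swap : ∀ i ∈ I \ D, ∀ j ∈ D \ I, M.Indep (insert j (I : Set X) \ {i}) → w j ≤ w i) :
    ∑ j ∈ D \ I, w j ≤ ∑ i ∈ I \ D, w i := by
  classical
  let T : Finset X := (D \ I).filter fun j => 0 < w j
  let N : T → Finset X := fun j =>
    (I \ D).filter fun i => M.Indep (insert (j : X) (I : Set X) \ {i})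
  have hT : ∀ j ∈ T, j ∈ D ∧ j ∉ I ∧ 0 < w j := fun j hj => by
    simpa [T, and_assoc] using hj
  have hall : ∀ S : Finset T, #S ≤ #(S.biUnion N) := by
    intro S
    have hcl : ((S.map (Function.Embedding.subtype _) ∪ (I ∩ D) : Finset X) : Set X)
        ⊆ M.closure ((S.biUnion N ∪ (I ∩ D) : Finset X) : Set X) := by
      intro j hj
      have hJE : ((S.biUnion N ∪ (I ∩ D) : Finset X) : Set X) ⊆ M.E := by
        refine Set.Subset.trans ?_ hI.subset_ground
        intro k hk
        simp only [coe_union, coe_biUnion, coe_inter, Set.mem_union, Set.mem_iUnion,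
          Set.mem_inter_iff, mem_coe, N, mem_filter, mem_sdiff] at hk
        rcases hk with ⟨_, _, hk⟩ | hk
        · exact hk.1.1
        · exact hk.1
      by_cases hjI : j ∈ I ∩ D
      · exact M.mem_closure_of_mem (by simpa using Or.inr (by simpa using hjI)) hJE
      have hjS : ∃ h : j ∈ T, (⟨j, h⟩ : T) ∈ S := by
        simp only [coe_union, Set.mem_union, mem_coe, hjI, or_false, mem_map] at hj
        obtain ⟨a, ha, rfl⟩ := hj
        exact ⟨a.2, ha⟩
      obtain ⟨hjT, hjS⟩ := hjS
      obtain ⟨hjD, hjnI, hjw⟩ := hT j hjT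
      have hjcl : j ∈ M.closure (I : Set X) := by
        by_contra hcon
        have := h_add j (mem_sdiff.2 ⟨hjD, hjnI⟩)
          ((hI.notMem_closure_iff_of_notMem (by simpa using hjnI)
            (hD.subset_ground (by simpa using hjD))).1 hcon)
        linarith
      have hcirc := hI.fundCircuit_isCircuit hjcl (by simpa using hjnI)
      refine M.closure_subset_closure ?_
        (hcirc.mem_closure_sdiff_singleton_of_mem (M.mem_fundCircuit j I))
      rintro i ⟨hi, hij⟩
      have hiI : i ∈ I := by
        simpa [show i ≠ j from hij] using M.fundCircuit_subset_insert j I hi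
      by_cases hiD : i ∈ D
      · simp [hiI, hiD]
      · have := (hI.mem_fundCircuit_iff hjcl (by simpa using hjnI)).1 hi
        simp only [coe_union, coe_biUnion, Set.mem_union, Set.mem_iUnion, mem_coe]
        exact Or.inl ⟨⟨j, hjT⟩, hjS, mem_filter.2 ⟨mem_sdiff.2 ⟨hiI, hiD⟩, this⟩⟩
    have hind : M.Indep ((S.map (Function.Embedding.subtype _) ∪ (I ∩ D) : Finset X) : Set X) := by
      refine hD.subset ?_
      intro j hj
      simp only [coe_union, Set.mem_union, mem_coe, mem_map, mem_inter] at hj ⊢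
      rcases hj with ⟨a, _, rfl⟩ | h
      · exact (hT a a.2).1
      · exact h.2
    have hle := (hind.encard_le_eRk_of_subset hcl).trans
      ((M.eRk_closure_eq _).le.trans (M.eRk_le_encard _))
    rw [Set.encard_coe_eq_coe_finsetCard, Set.encard_coe_eq_coe_finsetCard, Nat.cast_le,
      card_union_of_disjoint, card_map] at hle
    · have := card_union_le (S.biUnion N) (I ∩ D)
      omega
    · rw [disjoint_left]
      intro j hj hj'
      obtain ⟨a, _, rfl⟩ := mem_map.1 hj
      exact (hT a a.2).2.1 (mem_inter.1 hj').1
  obtain ⟨m, hm_inj, hm⟩ := (all_card_le_biUnion_card_iff_exists_injective N).1 hall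
  calc ∑ j ∈ D \ I, w j ≤ ∑ j ∈ T, w j := by
        rw [sum_filter]
        refine sum_le_sum fun j _ => ?_
        split_ifs with h
        · exact le_rfl
        · exact not_lt.1 h
    _ = ∑ j : T, w j := (sum_coe_sort T w).symm
    _ ≤ ∑ j : T, w (m j) := sum_le_sum fun j _ => by
        have h := mem_filter.1 (hm j)
        exact h_swap _ h.1 j (mem_sdiff.2 ⟨(hT j j.2).1, (hT j j.2).2.1⟩) h.2
    _ = ∑ i ∈ univ.image m, w i := (sum_image fun a _ b _ h => hm_inj h).symm
    _ ≤ ∑ i ∈ I \ D, w i := by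
        refine sum_le_sum_of_subset_of_nonneg ?_ fun i hi _ => h_remove i hi
        intro i hi
        obtain ⟨j, _, rfl⟩ := mem_image.1 hi
        exact (mem_filter.1 (hm j)).1

lemma nonneg_of_mem_convexHull_indep {X : Type*} {M : Matroid X} {y : X → ℝ}
    (hy : y ∈ convexHull ℝ {v : X → ℝ | ∃ I : Set X, M.Indep I ∧ v = Set.indicator I 1}) :
    0 ≤ y := by
  refine convexHull_min ?_ (convex_Ici (0 : X → ℝ)) hy
  rintro _ ⟨I, -, rfl⟩ i
  exact Set.indicator_nonneg (fun _ _ => zero_le_one) i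

open Filter Topology in
/-- Replacing an independent set `z k` of positive weight in a convex combination by another
independent set `J` gives a feasible direction, provided that the coordinates in `J \ z k` are not
tight for the box constraint. -/
lemma exists_add_smul_mem_indepPolytopeT {X ι : Type*} [Fintype X] [Fintype ι] {M : Matroid X}
    {t : ℝ} {x : X → ℝ} (hx : x ∈ indepPolytopeT M t) {w : ι → ℝ} {z : ι → Set X}
    (hw : ∀ k, 0 ≤ w k) (hw1 : ∑ k, w k = 1) (hz : ∀ k, M.Indep (z k))
    (hxz : ∑ k, w k • (z k).indicator 1 = x) {k : ι} (hk : 0 < w k) {J : Set X}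
    (hJ : M.Indep J) (hJt : ∀ i ∈ J, i ∉ z k → x i < t) :
    ∃ ε > (0 : ℝ), x + ε • (J.indicator 1 - (z k).indicator 1 : X → ℝ) ∈ indepPolytopeT M t := by
  classical
  set d : X → ℝ := J.indicator 1 - (z k).indicator 1 with hd
  set K := {v : X → ℝ | ∃ I : Set X, M.Indep I ∧ v = Set.indicator I 1} with hK
  have hmem : x + w k • d ∈ convexHull ℝ K := by
    have h := (convex_convexHull ℝ K).sum_mem (t := Finset.univ) (w := w)
      (z := Function.update (fun l => (z l).indicator 1) k (J.indicator 1))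
      (fun l _ => hw l) hw1 fun l _ => by
        refine subset_convexHull ℝ K ?_
        by_cases hl : l = k
        · subst hl
          exact ⟨J, hJ, by simp⟩
        · exact ⟨z l, hz l, by simp [hl]⟩
    convert h using 1
    have hsum : ∑ l ∈ Finset.univ.erase k,
          w l • Function.update (fun l => (z l).indicator 1) k (J.indicator 1) l
        = ∑ l ∈ Finset.univ.erase k, w l • ((z l).indicator 1 : X → ℝ) :=
      Finset.sum_congr rfl fun l hl => by
        rw [Function.update_of_ne (Finset.ne_of_mem_erase hl)]
    rw [← hxz, ← Finset.add_sum_erase _ _ (Finset.mem_univ k),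
      ← Finset.add_sum_erase (a := k) _ _ (Finset.mem_univ k), Function.update_self, hsum]
    rw [hd]
    module
  have hhull : ∀ ε ∈ Set.Ioc 0 (w k), x + ε • d ∈ convexHull ℝ K := fun ε hε => by
    have h := (convex_convexHull ℝ K).add_smul_mem hx.1 hmem
      (t := ε / w k) ⟨div_nonneg hε.1.le hk.le, (div_le_one hk).2 hε.2⟩
    rwa [smul_smul, div_mul_cancel₀ _ hk.ne'] at h
  have hbox : ∀ᶠ ε in 𝓝[>] (0 : ℝ), ∀ i, x i + ε * d i ≤ t := by
    rw [eventually_all]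
    intro i
    by_cases hi : i ∈ J ∧ i ∉ z k
    · have hc : Tendsto (fun ε : ℝ => x i + ε * d i) (𝓝 0) (𝓝 (x i + 0 * d i)) :=
        Continuous.tendsto (by fun_prop) 0
      rw [zero_mul, add_zero] at hc
      exact nhdsWithin_le_nhds ((hc.eventually_lt_const (hJt i hi.1 hi.2)).mono fun _ => le_of_lt)
    · filter_upwards [self_mem_nhdsWithin] with ε hε
      have hdi : d i ≤ 0 := by
        by_cases h1 : i ∈ J <;> by_cases h2 : i ∈ z k <;> simp_all
      have := (hx.2 i).2
      have := mul_nonpos_of_nonneg_of_nonpos (le_of_lt hε) hdi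
      linarith
  obtain ⟨ε, hεt, hε⟩ := (hbox.and (Ioc_mem_nhdsGT hk)).exists
  exact ⟨ε, hε.1, hhull ε hε, fun i =>
    ⟨nonneg_of_mem_convexHull_indep (hhull ε hε) i, hεt i⟩⟩

/-- if `x ∈ P_t(M)` is a fractional local optimum of the multilinear
extension `F` of a nonnegative submodular `f`, then for every independent set `C`,
with `C' = {i ∈ C : x_i < t}`, one has `2 F(x) ≥ F(x ∨ 1_{C'}) + F(x ∧ 1_C)`. -/
theorem stmt_11 {X : Type*} [Fintype X] [DecidableEq X] (M : Matroid X)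
    (hE : M.E = Set.univ)
    (f : Set X → ℝ) (hf0 : ∀ S : Set X, 0 ≤ f S)
    (hsub : ∀ S T : Set X, f (S ∪ T) + f (S ∩ T) ≤ f S + f T)
    (t : ℝ) (ht : t ∈ Set.Icc (0 : ℝ) 1)
    (x : X → ℝ) (hx : x ∈ indepPolytopeT M t)
    (hloc1 : ∀ i : X, (∃ ε > (0 : ℝ), x - ε • (Pi.single i 1 : X → ℝ) ∈ indepPolytopeT M t) →
      0 ≤ fderiv ℝ (mExt f) x (Pi.single i 1))
    (hloc2 : ∀ j : X, (∃ ε > (0 : ℝ), x + ε • (Pi.single j 1 : X → ℝ) ∈ indepPolytopeT M t) →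
      fderiv ℝ (mExt f) x (Pi.single j 1) ≤ 0)
    (hloc3 : ∀ i j : X,
      (∃ ε > (0 : ℝ), x + ε • ((Pi.single j 1 : X → ℝ) - Pi.single i 1) ∈ indepPolytopeT M t) →
      fderiv ℝ (mExt f) x (Pi.single j 1) ≤ fderiv ℝ (mExt f) x (Pi.single i 1)) :
    ∀ C : Set X, M.Indep C →
      mExt f (x ⊔ Set.indicator {i | i ∈ C ∧ x i < t} 1)
        + mExt f (x ⊓ Set.indicator C 1) ≤ 2 * mExt f x := by
  classical
  intro C hC
  simp only [fderiv_mExt_single] at hloc1 hloc2 hloc3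
  set g : X → ℝ := fun i => mExtSlope f i x with hg
  have hx01 : ∀ i, x i ∈ Set.Icc (0 : ℝ) 1 := fun i =>
    ⟨(hx.2 i).1, (hx.2 i).2.trans ht.2⟩
  set C' : Set X := {i | i ∈ C ∧ x i < t} with hC'
  have hind01 : ∀ (S : Set X) (i : X), S.indicator (1 : X → ℝ) i ∈ Set.Icc (0 : ℝ) 1 :=
    fun S i => by by_cases hi : i ∈ S <;> simp [hi]
  have hup := mExt_le_add_sum hsub hx01 (y := x ⊔ C'.indicator 1)
    (fun i => ⟨(hx01 i).1.trans le_sup_left, sup_le (hx01 i).2 (hind01 C' i).2⟩)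
    (Or.inl le_sup_left)
  have hdown := mExt_le_add_sum hsub hx01 (y := x ⊓ C.indicator 1)
    (fun i => ⟨le_inf (hx01 i).1 (hind01 C i).1, inf_le_left.trans (hx01 i).2⟩)
    (Or.inr inf_le_left)
  suffices h : ∑ i, ((x ⊔ C'.indicator 1) i - x i) * g i
      + ∑ i, ((x ⊓ C.indicator 1) i - x i) * g i ≤ 0 by
    linarith
  obtain ⟨ι, _, w, v, hw, hw1, hv, hwv⟩ := mem_convexHull_iff_exists_fintype.1 hx.1
  choose z hz hvz using hv
  have hwz : ∑ k, w k • (z k).indicator 1 = x := by rw [← hwv]; simp only [hvz]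
  have hxi : ∀ i, ∑ k, w k * (z k).indicator 1 i = x i := fun i => by
    rw [← hwz]; simp
  have hterm : ∀ k, w k * ∑ i, ((C'.indicator 1 i * (1 - (z k).indicator 1 i))
      - (1 - C.indicator 1 i) * (z k).indicator 1 i) * g i ≤ 0 := by
    intro k
    rcases (hw k).eq_or_lt with hk | hk
    · simp [← hk]
    refine mul_nonpos_of_nonneg_of_nonpos hk.le ?_
    have hdir : ∀ J : Set X, M.Indep J → (∀ i ∈ J, i ∉ z k → x i < t) →
        ∃ ε > (0 : ℝ), x + ε • (J.indicator 1 - (z k).indicator 1 : X → ℝ) ∈ indepPolytopeT M t :=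
      fun J hJ hJt => exists_add_smul_mem_indepPolytopeT hx hw hw1 hz hwz hk hJ hJt
    have h1 : ∀ i ∈ z k, 0 ≤ g i := by
      intro i hi
      obtain ⟨ε, hε, h⟩ := hdir (z k \ {i}) ((hz k).sdiff _) fun j hj hj' => absurd hj.1 hj'
      refine hloc1 i ⟨ε, hε, ?_⟩
      convert h using 1
      rw [sub_eq_add_neg, ← smul_neg]
      congr 2
      ext j
      by_cases hj : j = i
      · subst hj; simp [hi]
      · by_cases hjz : j ∈ z k <;> simp [hj, hjz]
    have h2 : ∀ j ∈ C', j ∉ z k → M.Indep (insert j (z k)) → g j ≤ 0 := by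
      intro j hj hjz hJ
      obtain ⟨ε, hε, h⟩ := hdir (insert j (z k)) hJ fun l hl hl' => by
        rw [hl.resolve_right hl']
        exact hj.2
      refine hloc2 j ⟨ε, hε, ?_⟩
      convert h using 3
      ext l
      by_cases hl : l = j
      · subst hl; simp [hjz]
      · by_cases hlz : l ∈ z k <;> simp [hl, hlz]
    have h3 : ∀ i ∈ z k, ∀ j ∈ C', j ∉ z k → M.Indep (insert j (z k) \ {i}) → g j ≤ g i := by
      intro i hi j hj hjz hJ
      obtain ⟨ε, hε, h⟩ := hdir _ hJ fun l hl hl' => by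
        rw [hl.1.resolve_right hl']
        exact hj.2
      refine hloc3 i j ⟨ε, hε, ?_⟩
      have hji : j ≠ i := fun h => hjz (h ▸ hi)
      convert h using 3
      ext l
      by_cases hl : l = j
      · subst hl; simp [hjz, hji]
      · by_cases hli : l = i
        · subst hli; simp [hl, hi]
        · by_cases hlz : l ∈ z k <;> simp [hl, hli, hlz]
    have hmain := Matroid.Indep.sum_sdiff_le_sum_sdiff (I := (z k).toFinset)
      (D := (C' ∪ (C ∩ z k)).toFinset) (by simpa using hz k)
      (by simpa using hC.subset (Set.union_subset (fun i hi => hi.1) Set.inter_subset_left)) g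
      (fun i hi => h1 i (by simp at hi; exact hi.1))
      (fun j hj hJ => h2 j (by simp at hj; tauto) (by simp at hj; tauto) (by simpa using hJ))
      (fun i hi j hj hJ => h3 i (by simp at hi; exact hi.1) j (by simp at hj; tauto)
        (by simp at hj; tauto) (by simpa using hJ))
    have hsum : ∀ s : Finset X, ∑ i ∈ s, g i = ∑ i, if i ∈ s then g i else 0 := fun s => by
      simp
    rw [hsum, hsum, ← sub_nonpos, ← Finset.sum_sub_distrib] at hmain
    refine le_of_eq_of_le (Finset.sum_congr rfl fun i _ => ?_) hmain
    by_cases hi : i ∈ C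
    · by_cases hi' : i ∈ C' <;> by_cases hiz : i ∈ z k <;> simp [hi, hi', hiz]
    · have hi' : i ∉ C' := fun h => hi h.1
      by_cases hiz : i ∈ z k <;> simp [hi, hi', hiz]
  calc _ = ∑ i, ∑ k, w k * (((C'.indicator 1 i * (1 - (z k).indicator 1 i))
      - (1 - C.indicator 1 i) * (z k).indicator 1 i) * g i) := by
        rw [← Finset.sum_add_distrib]
        refine Finset.sum_congr rfl fun i _ => ?_
        have e : ∑ k, w k * (((C'.indicator 1 i * (1 - (z k).indicator 1 i))
            - (1 - C.indicator 1 i) * (z k).indicator 1 i) * g i)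
            = (C'.indicator 1 i * (∑ k, w k - ∑ k, w k * (z k).indicator 1 i)
              - (1 - C.indicator 1 i) * ∑ k, w k * (z k).indicator 1 i) * g i := by
          rw [← Finset.sum_sub_distrib, Finset.mul_sum, Finset.mul_sum,
            ← Finset.sum_sub_distrib, Finset.sum_mul]
          exact Finset.sum_congr rfl fun k _ => by ring
        rw [e, hw1, hxi, ← add_mul]
        congr 1
        have h0 := (hx01 i).1
        have h1 := (hx01 i).2
        by_cases hi : i ∈ C <;> by_cases hi' : i ∈ C'
        · simp [hi, hi', h0, h1]
        · simp [hi, hi', h0, h1]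
        · exact absurd hi'.1 hi
        · simp [hi, hi', h0, h1]
    _ = ∑ k, w k * ∑ i, ((C'.indicator 1 i * (1 - (z k).indicator 1 i))
      - (1 - C.indicator 1 i) * (z k).indicator 1 i) * g i := by
        rw [Finset.sum_comm]
        simp only [Finset.mul_sum]
    _ ≤ 0 := Finset.sum_nonpos fun k _ => hterm k
end

section
/- Let X be a finite set, 𝒢 a group of permutations of X, f : 2^X → ℝ a set function invariant under 𝒢 with multilinear extension F, and ℱ ⊆ 2^X a family of sets invariant under 𝒢 (S ∈ ℱ ⟺ σ(S) ∈ ℱ for all σ ∈ 𝒢). Let P(ℱ) = conv{1_S : S ∈ ℱ}, and for x ∈ [0,1]^X let x̄ = (1/|𝒢|) ∑_{σ∈𝒢} σ(x). Suppose x₀ ∈ P(ℱ) attains the maximum of F(x̄) over x ∈ P(ℱ) and satisfies x̄₀ = x₀. Then x₀ is a local optimum for maximizing F over P(ℱ): for every x ∈ P(ℱ), (x − x₀) · ∇F(x₀) ≤ 0. -/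
open scoped Classical

/-- The symmetrization `x̄ = (1/|𝒢|) ∑_{σ∈𝒢} σ(x)`, where `(σ(x))_i = x_{σ⁻¹(i)}`. -/
noncomputable def symmetrize {X : Type*} [Fintype X] (G : Subgroup (Equiv.Perm X))
    (x : X → ℝ) : X → ℝ :=
  fun i => (∑ σ : G, x ((σ : Equiv.Perm X)⁻¹ i)) / (Fintype.card G)

section Reindexing

variable {X : Type*}

/-- The action `x ↦ x ∘ σ` of a map `σ` on vectors, as a continuous linear map. -/
noncomputable def reindexCLM (σ : X → X) : (X → ℝ) →L[ℝ] (X → ℝ) :=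
  ContinuousLinearMap.pi fun i => ContinuousLinearMap.proj (σ i)

theorem reindexCLM_apply (σ : X → X) (x : X → ℝ) : reindexCLM σ x = x ∘ σ := rfl

/-- Symmetrization as a continuous linear map. -/
noncomputable def symmetrizeCLM [Fintype X] (G : Subgroup (Equiv.Perm X)) :
    (X → ℝ) →L[ℝ] (X → ℝ) :=
  (Fintype.card G : ℝ)⁻¹ • ∑ σ : G, reindexCLM ((σ : Equiv.Perm X)⁻¹ : Equiv.Perm X)

theorem symmetrizeCLM_apply [Fintype X] (G : Subgroup (Equiv.Perm X)) (x : X → ℝ) :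
    symmetrizeCLM G x = symmetrize G x := by
  ext i
  simp [symmetrizeCLM, symmetrize, reindexCLM_apply, sum_apply,
    div_eq_inv_mul]

theorem symmetrize_comp_perm [Fintype X] (G : Subgroup (Equiv.Perm X)) (x : X → ℝ)
    {τ : Equiv.Perm X} (hτ : τ ∈ G) : symmetrize G x ∘ τ = symmetrize G x := by
  ext i
  simp only [symmetrize, Function.comp_apply]
  congr 1
  refine Fintype.sum_equiv (Equiv.mulLeft (⟨τ, hτ⟩ : G)⁻¹) _ _ fun σ => ?_
  simp

theorem differentiable_mExt [Fintype X] [DecidableEq X] (f : Set X → ℝ) :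
    Differentiable ℝ (mExt f) := by
  unfold mExt
  fun_prop

theorem mExt_comp_perm [Fintype X] [DecidableEq X] {f : Set X → ℝ} {τ : Equiv.Perm X}
    (hf : ∀ S : Set X, f (τ '' S) = f S) (x : X → ℝ) : mExt f (x ∘ τ) = mExt f x := by
  unfold mExt
  refine Fintype.sum_equiv (Equiv.finsetCongr τ) _ _ fun S => ?_
  have hc : (S.map τ.toEmbedding)ᶜ = Sᶜ.map τ.toEmbedding := by
    ext i
    simp [Finset.mem_map_equiv]
  rw [Equiv.finsetCongr_apply, hc, Finset.prod_map, Finset.prod_map, Finset.coe_map]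
  simp [hf]

theorem fderiv_mExt_comp_perm [Fintype X] [DecidableEq X] {f : Set X → ℝ} {τ : Equiv.Perm X}
    (hf : ∀ S : Set X, f (τ '' S) = f S) {x₀ : X → ℝ} (hx₀ : x₀ ∘ τ = x₀) (v : X → ℝ) :
    fderiv ℝ (mExt f) x₀ (v ∘ τ) = fderiv ℝ (mExt f) x₀ v := by
  have h : HasFDerivAt (mExt f ∘ reindexCLM τ)
      ((fderiv ℝ (mExt f) x₀).comp (reindexCLM τ)) x₀ := by
    refine HasFDerivAt.comp x₀ ?_ (reindexCLM τ).hasFDerivAt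
    rw [reindexCLM_apply, hx₀]
    exact (differentiable_mExt f x₀).hasFDerivAt
  have hinv : mExt f ∘ reindexCLM τ = mExt f := funext fun x => mExt_comp_perm hf x
  rw [hinv] at h
  exact (DFunLike.congr_fun h.fderiv v).symm

theorem fderiv_mExt_symmetrize [Fintype X] [DecidableEq X] {G : Subgroup (Equiv.Perm X)}
    {f : Set X → ℝ} (hf : ∀ σ ∈ G, ∀ S : Set X, f ((σ : Equiv.Perm X) '' S) = f S)
    {x₀ : X → ℝ} (hx₀ : symmetrize G x₀ = x₀) (v : X → ℝ) :
    fderiv ℝ (mExt f) x₀ (symmetrize G v) = fderiv ℝ (mExt f) x₀ v := by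
  have hσ (σ : G) : fderiv ℝ (mExt f) x₀ (v ∘ ((σ : Equiv.Perm X)⁻¹ : Equiv.Perm X)) =
      fderiv ℝ (mExt f) x₀ v := by
    have hmem : (σ : Equiv.Perm X)⁻¹ ∈ G := G.inv_mem σ.2
    refine fderiv_mExt_comp_perm (hf _ hmem) ?_ v
    rw [← hx₀]
    exact symmetrize_comp_perm G x₀ hmem
  rw [← symmetrizeCLM_apply]
  simp [symmetrizeCLM, sum_apply, reindexCLM_apply, -Equiv.Perm.coe_inv, hσ]

end Reindexing

/-- if `f` and `ℱ` are invariant under a group `𝒢` of permutations of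
`X`, and `x₀ ∈ P(ℱ)` is a symmetric point (`x̄₀ = x₀`) attaining the maximum of
`F(x̄)` over `P(ℱ)`, then `x₀` is a local optimum of `F` over `P(ℱ)`:
`(x - x₀)·∇F(x₀) ≤ 0` for every `x ∈ P(ℱ)`. -/
theorem stmt_15 {X : Type*} [Fintype X] [DecidableEq X] (G : Subgroup (Equiv.Perm X))
    (f : Set X → ℝ)
    (hfinv : ∀ σ ∈ G, ∀ S : Set X, f ((σ : Equiv.Perm X) '' S) = f S)
    (Fam : Set (Set X))
    (hFaminv : ∀ σ ∈ G, ∀ S : Set X, S ∈ Fam ↔ (σ : Equiv.Perm X) '' S ∈ Fam)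
    (x₀ : X → ℝ)
    (hx₀P : x₀ ∈ (convexHull ℝ) {v : X → ℝ | ∃ S ∈ Fam, v = Set.indicator S 1})
    (hx₀sym : symmetrize G x₀ = x₀)
    (hmax : ∀ x ∈ (convexHull ℝ) {v : X → ℝ | ∃ S ∈ Fam, v = Set.indicator S 1},
      mExt f (symmetrize G x) ≤ mExt f (symmetrize G x₀)) :
    ∀ x ∈ (convexHull ℝ) {v : X → ℝ | ∃ S ∈ Fam, v = Set.indicator S 1},
      ∑ i, (x i - x₀ i) * fderiv ℝ (mExt f) x₀ (Pi.single i 1) ≤ 0 := by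
  intro x hx
  have hder : HasFDerivAt (mExt f ∘ symmetrizeCLM G)
      ((fderiv ℝ (mExt f) x₀).comp (symmetrizeCLM G)) x₀ := by
    refine HasFDerivAt.comp x₀ ?_ (symmetrizeCLM G).hasFDerivAt
    rw [symmetrizeCLM_apply, hx₀sym]
    exact (differentiable_mExt f x₀).hasFDerivAt
  have hmaxOn : IsMaxOn (mExt f ∘ symmetrizeCLM G)
      ((convexHull ℝ) {v : X → ℝ | ∃ S ∈ Fam, v = Set.indicator S 1}) x₀ := fun y hy => by
    simpa [symmetrizeCLM_apply] using hmax y hy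
  have hle := hmaxOn.localize.hasFDerivWithinAt_nonpos hder.hasFDerivWithinAt
    (sub_mem_posTangentConeAt_of_segment_subset ((convex_convexHull ℝ _).segment_subset hx₀P hx))
  rw [ContinuousLinearMap.comp_apply, symmetrizeCLM_apply,
    fderiv_mExt_symmetrize hfinv hx₀sym] at hle
  rw [pi_eq_sum_univ' (x - x₀), map_sum] at hle
  simpa only [map_smul, smul_eq_mul, Pi.sub_apply] using hle
end
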